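/- Let g(x) = g_0 x + g_1 x^q + ... + g_{n−1} x^{q^{n−1}} be a linearized polynomial over F_{q^n} whose associated F_q-linear map has rank t with 1 ≤ t ≤ n−1, and let M be its Dickson matrix. Then there exist unique λ_1, ..., λ_t ∈ F_{q^n} such that row 0 of M is the linear combination Σ_{i=1}^{t} λ_i · (row i of M); explicitly, for every j with 0 ≤ j ≤ n−1, g_{(−j) mod n}^{q^j} = Σ_{i=1}^{t} λ_i · g_{(i−j) mod n}^{q^j}. -/

import Mathlib

open Polynomial

section DicksonAux

variable {K L : Type*} [Field K] [Fintype K] [Field L] [Fintype L] [Algebra K L]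

/-- The linear map `x ↦ x ^ q ^ k`. -/
noncomputable def frobPow (K L : Type*) [Field K] [Fintype K] [Field L] [Fintype L] [Algebra K L]
    (k : ℕ) : L ≃ₐ[K] L :=
  (FiniteField.frobeniusAlgEquivOfAlgebraic K L) ^ k

lemma frobPow_apply (k : ℕ) (x : L) : frobPow K L k x = x ^ Fintype.card K ^ k := by
  unfold frobPow
  induction k generalizing x with
  | zero => simp
  | succ k ih =>
    rw [pow_succ, AlgEquiv.mul_apply, ih]
    simp [pow_succ', pow_mul]

/-- The linear map given by a linearized polynomial. -/
noncomputable def linPoly (K : Type*) {L : Type*} [Field K] [Fintype K] [Field L] [Fintype L]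
    [Algebra K L] {m : ℕ} (e : ℕ) (c : Fin m → L) : L →ₗ[K] L :=
  ∑ i : Fin m, LinearMap.mulLeft K (c i) ∘ₗ (frobPow K L (i + e)).toLinearMap

lemma linPoly_apply {m : ℕ} (e : ℕ) (c : Fin m → L) (x : L) :
    linPoly K e c x = ∑ i : Fin m, c i * x ^ Fintype.card K ^ ((i : ℕ) + e) := by
  simp [linPoly, frobPow_apply]

lemma coeff_zero_of_vanish {m : ℕ} (c : Fin m → L) (W : Submodule K L)
    (hW : m ≤ Module.finrank K W)
    (h : ∀ z ∈ W, ∑ i : Fin m, c i * z ^ Fintype.card K ^ (i : ℕ) = 0) : c = 0 := by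
  classical
  have hq : 1 < Fintype.card K := Fintype.one_lt_card
  let p : L[X] := ∑ i : Fin m, C (c i) * X ^ Fintype.card K ^ (i : ℕ)
  have hp : p = 0 := by
    rcases Nat.eq_zero_or_pos m with rfl | hm
    · simp [p]
    apply Polynomial.eq_zero_of_natDegree_lt_card_of_eval_eq_zero' p
      (Finset.univ.filter (· ∈ W))
    · intro z hz
      simpa [p, eval_finsetSum] using h z (by simpa using hz)
    · have hc : (Finset.univ.filter (· ∈ W)).card = Fintype.card K ^ Module.finrank K W := by
        rw [← Module.card_eq_pow_finrank (K := K) (V := W), Fintype.card_subtype]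
      rw [hc]
      refine lt_of_le_of_lt (b := Fintype.card K ^ (m - 1)) ?_
        (Nat.pow_lt_pow_right hq (by omega))
      apply natDegree_sum_le_of_forall_le
      intro i _
      refine (natDegree_C_mul_X_pow_le _ _).trans (Nat.pow_le_pow_right (by omega) ?_)
      have := i.isLt
      omega
  funext i
  have := congrArg (fun r : L[X] => r.coeff (Fintype.card K ^ (i : ℕ))) hp
  simp only [p, finsetSum_coeff, coeff_C_mul, coeff_X_pow, coeff_zero] at this
  rw [Finset.sum_eq_single i] at this
  · simpa using this
  · intro j _ hj
    rw [if_neg, mul_zero]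
    intro hh
    exact hj (Fin.ext (Nat.pow_right_injective hq hh.symm))
  · simp

lemma coeff_zero_of_vanish' {m : ℕ} (c : Fin m → L) (W : Submodule K L)
    (hW : m ≤ Module.finrank K W)
    (h : ∀ z ∈ W, linPoly K 1 c z = 0) : c = 0 := by
  apply coeff_zero_of_vanish c (W.map (frobPow K L 1).toLinearEquiv.toLinearMap)
  · rw [LinearEquiv.finrank_map_eq]; exact hW
  · rintro _ ⟨z, hz, rfl⟩
    rw [← h z hz, linPoly_apply]
    refine Finset.sum_congr rfl fun i _ => ?_
    simp [frobPow_apply, pow_add, ← pow_mul, mul_comm]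

lemma exists_combo {t : ℕ} (W : Submodule K L) (hW : Module.finrank K W = t) :
    ∃ lam : Fin t → L, ∀ z ∈ W, z = linPoly K 1 lam z := by
  let b := Module.finBasisOfFinrankEq K W hW
  have ext : ∀ f : L →ₗ[K] L, (∀ k, f (b k) = 0) → ∀ z ∈ W, f z = 0 := by
    intro f hf z hz
    have : f ∘ₗ W.subtype = 0 := b.ext fun k => by simpa using hf k
    exact LinearMap.congr_fun this ⟨z, hz⟩
  let T : (Fin t → L) →ₗ[L] (Fin t → L) :=
    { toFun := fun c k => linPoly K 1 c (b k)
      map_add' := by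
        intro c d; funext k
        simp [linPoly_apply, add_mul, Finset.sum_add_distrib]
      map_smul' := by
        intro a c; funext k
        simp [linPoly_apply, Finset.mul_sum, mul_assoc] }
  have hinj : Function.Injective T := by
    rw [injective_iff_map_eq_zero]
    intro c hc
    exact coeff_zero_of_vanish' c W hW.ge (ext _ fun k => congrFun hc k)
  obtain ⟨lam, hl⟩ := LinearMap.injective_iff_surjective.1 hinj (fun k => (b k : L))
  refine ⟨lam, fun z hz => ?_⟩
  have := ext (LinearMap.id - linPoly K 1 lam) (fun k => by
    have : linPoly K 1 lam (b k) = b k := congrFun hl k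
    simp [this]) z hz
  simpa [sub_eq_zero] using this

lemma frob_pow_mod {n : ℕ} (hn : Module.finrank K L = n) (k : ℕ) (x : L) :
    x ^ Fintype.card K ^ (k % n) = x ^ Fintype.card K ^ k := by
  have hc : Fintype.card L = Fintype.card K ^ n := by
    rw [← hn]; exact Module.card_eq_pow_finrank
  conv_rhs => rw [← Nat.mod_add_div k n, pow_add, pow_mul, pow_mul (Fintype.card K), ← hc,
    FiniteField.pow_card_pow]

lemma finrank_adjoint (φ ψ : L →ₗ[K] L)
    (h : ∀ x y, Algebra.trace K L (ψ y * x) = Algebra.trace K L (y * φ x)) :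
    Module.finrank K (LinearMap.range ψ) = Module.finrank K (LinearMap.range φ) := by
  let D := (Algebra.traceForm K L).toDual (traceForm_nondegenerate K L)
  have hD : D.toLinearMap ∘ₗ ψ = φ.dualMap ∘ₗ D.toLinearMap := by
    ext y x
    simpa [D, LinearMap.BilinForm.toDual_def, Algebra.traceForm_apply] using h x y
  rw [← LinearMap.finrank_range_dualMap_eq_finrank_range φ,
    ← LinearEquiv.finrank_map_eq D, ← LinearMap.range_comp]
  have : LinearMap.range φ.dualMap = LinearMap.range (φ.dualMap ∘ₗ D.toLinearMap) := by
    rw [LinearMap.range_comp_of_range_eq_top _ D.range]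
  rw [this, ← hD]

end DicksonAux


/-- Let `g(x) = Σ_{i<n} g_i x^{q^i}` have rank `t` with `1 ≤ t ≤ n - 1`, and let `M` be
its Dickson matrix (`M_{i,j} = g_{(i-j) mod n}^{q^j}`). Then there exist unique
`λ_1, …, λ_t ∈ F_{q^n}` such that row `0` of `M` equals `Σ_{i=1}^{t} λ_i · (row i of M)`,
i.e. `g_{(-j) mod n}^{q^j} = Σ_i λ_i g_{(i-j) mod n}^{q^j}` for all `j`. -/
theorem dickson_matrix_first_row_unique_combination
    (Fq Fqn : Type*) [Field Fq] [Fintype Fq] [Field Fqn] [Fintype Fqn]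
    [Algebra Fq Fqn] (n t : ℕ) (hn : Module.finrank Fq Fqn = n)
    (ht1 : 1 ≤ t) (ht2 : t ≤ n - 1)
    (g : Fin n → Fqn) (φ : Fqn →ₗ[Fq] Fqn)
    (hφ : ∀ x : Fqn, φ x = ∑ i : Fin n, g i * x ^ (Fintype.card Fq) ^ (i : ℕ))
    (hrank : Module.finrank Fq (LinearMap.range φ) = t) :
    let M : Matrix (Fin n) (Fin n) Fqn :=
      Matrix.of fun i j : Fin n => g (i - j) ^ (Fintype.card Fq) ^ (j : ℕ)
    ∃! lam : Fin t → Fqn, ∀ j : Fin n,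
      M ⟨0, by omega⟩ j =
        ∑ i : Fin t, lam i * M ⟨(i : ℕ) + 1, by have := i.isLt; omega⟩ j := by
  intro M
  have hn0 : NeZero n := ⟨by omega⟩
  set ψ : Fqn →ₗ[Fq] Fqn := linPoly Fq 0 (fun j : Fin n => M 0 j) with hψ
  have hψa : ∀ y, ψ y = ∑ j : Fin n, M 0 j * y ^ Fintype.card Fq ^ (j : ℕ) := by
    intro y; simp [hψ, linPoly_apply]
  have hadd : ∀ (a b : Fin n) (x : Fqn), x ^ Fintype.card Fq ^ ((a + b : Fin n) : ℕ) =
      x ^ Fintype.card Fq ^ ((a : ℕ) + b) := by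
    intro a b x
    rw [Fin.val_add, frob_pow_mod hn]
  -- rows of `M`
  have hrow : ∀ (i : Fin n) (y : Fqn), ∑ j : Fin n, M i j * y ^ Fintype.card Fq ^ (j : ℕ) =
      ψ y ^ Fintype.card Fq ^ (i : ℕ) := by
    intro i y
    rw [hψa, ← frobPow_apply, map_sum, ← Equiv.sum_comp (Equiv.addRight i)]
    refine Finset.sum_congr rfl fun j _ => ?_
    rw [frobPow_apply]
    simp only [M, Matrix.of_apply, Equiv.coe_addRight, hadd]
    have : i - (j + i) = 0 - j := by abel
    rw [this, mul_pow, ← pow_mul, ← pow_mul, ← pow_add]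
  have hadj : ∀ x y, Algebra.trace Fq Fqn (ψ y * x) = Algebra.trace Fq Fqn (y * φ x) := by
    intro x y
    rw [hψa, hφ, Finset.sum_mul, Finset.mul_sum, map_sum, map_sum,
      ← Equiv.sum_comp (Equiv.neg (Fin n)) (fun i => Algebra.trace Fq Fqn (y * (g i * _)))]
    refine Finset.sum_congr rfl fun j _ => ?_
    rw [← Algebra.trace_eq_of_algEquiv (frobPow Fq Fqn (j : ℕ)) (y * _), frobPow_apply]
    congr 1
    simp only [M, Matrix.of_apply, Equiv.neg_apply, zero_sub, mul_pow]
    rw [← pow_mul x, ← pow_add, ← hadd, neg_add_cancel]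
    simp
    ring
  have hr : Module.finrank Fq (LinearMap.range ψ) = t := (finrank_adjoint φ ψ hadj).trans hrank
  have key : ∀ lam : Fin t → Fqn, (∀ j : Fin n, M ⟨0, by omega⟩ j =
        ∑ i : Fin t, lam i * M ⟨(i : ℕ) + 1, by have := i.isLt; omega⟩ j) ↔
      ∀ z ∈ LinearMap.range ψ, z = linPoly Fq 1 lam z := by
    intro lam
    have hsum : ∀ y, ∑ j : Fin n, (M 0 j -
        ∑ i : Fin t, lam i * M ⟨(i : ℕ) + 1, by have := i.isLt; omega⟩ j) *
          y ^ Fintype.card Fq ^ (j : ℕ) = ψ y - linPoly Fq 1 lam (ψ y) := by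
      intro y
      simp only [sub_mul, Finset.sum_sub_distrib, Finset.sum_mul]
      rw [hrow, linPoly_apply 1 lam, Finset.sum_comm]
      congr 1
      · simp
      · refine Finset.sum_congr rfl fun i _ => ?_
        rw [← hrow ⟨(i : ℕ) + 1, by have := i.isLt; omega⟩, Finset.mul_sum]
        exact Finset.sum_congr rfl fun j _ => mul_assoc _ _ _
    constructor
    · rintro h _ ⟨y, rfl⟩
      rw [← sub_eq_zero, ← hsum]
      refine Finset.sum_eq_zero fun j _ => ?_
      rw [← h j]
      exact mul_eq_zero_of_left (sub_self _) _
    · intro h j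
      have := coeff_zero_of_vanish (K := Fq) _ ⊤ (by rw [finrank_top, hn])
        (fun y _ => (hsum y).trans (sub_eq_zero.2 (h _ ⟨y, rfl⟩)))
      exact sub_eq_zero.1 (congrFun this j)
  obtain ⟨lam, hl⟩ := exists_combo (LinearMap.range ψ) hr
  refine ⟨lam, (key lam).2 hl, fun lam' h' => ?_⟩
  have h2 := (key lam').1 h'
  have := coeff_zero_of_vanish' (lam' - lam) (LinearMap.range ψ) hr.ge (fun z hz => by
    have e : linPoly Fq 1 (lam' - lam) z = linPoly Fq 1 lam' z - linPoly Fq 1 lam z := by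
      simp [linPoly_apply, sub_mul, Finset.sum_sub_distrib]
    rw [e, ← h2 z hz, ← hl z hz, sub_self])
  exact sub_eq_zero.1 this
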